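/- arXiv:2503.03530 — 4 statements merged into one kernel-verified Lean document; each statement's English description precedes it below -/
import Mathlib

section
/- For all v ∈ ℝ and h > 0, the integral ∫_ℝ K((x−v)/h)·ρ(x) dx is finite and equals h·ρ(v) + h³·(ρ''(v)/2)·m₂ + R(v,h), where the remainder satisfies |R(v,h)| ≤ h³·( ‖ρ''‖_∞ · ∫_{|x|>h^{−1/2}} x²K(x) dx + (m₂/2)·sup_{|s−v|≤h^{1/2}} |ρ''(s)−ρ''(v)| ). In particular R(v,h) = O(h³) as h → 0, and if ρ'' is continuous at v then R(v,h) = o(h³) as h → 0. -/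
open MeasureTheory Filter Asymptotics

lemma taylor_two (ρ ρ' ρ'' : ℝ → ℝ)
    (hρ : ∀ x, HasDerivAt ρ (ρ' x) x) (hρ' : ∀ x, HasDerivAt ρ' (ρ'' x) x) (v t : ℝ) :
    ∃ ξ, |ξ - v| ≤ |t| ∧ ρ (v + t) = ρ v + t * ρ' v + t ^ 2 / 2 * ρ'' ξ := by
  set c := ρ (v + t) - ρ v - t * ρ' v with hc
  have haff : ∀ s : ℝ, HasDerivAt (fun s : ℝ => v + s * t) t s := by
    intro s
    simpa using ((hasDerivAt_id s).mul_const t).const_add v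
  have h1 : ∀ s : ℝ, HasDerivAt (fun s : ℝ => ρ (v + s * t) - s * (t * ρ' v) - s ^ 2 * c)
      (ρ' (v + s * t) * t - t * ρ' v - 2 * s * c) s := by
    intro s
    have a := (hρ (v + s * t)).comp s (haff s)
    have b := (hasDerivAt_id s).mul_const (t * ρ' v)
    have d := (hasDerivAt_pow 2 s).mul_const c
    exact ((a.sub b).sub d).congr_deriv (by simp)
  have h2 : ∀ s : ℝ, HasDerivAt (fun s : ℝ => ρ' (v + s * t) * t - t * ρ' v - 2 * s * c)
      (ρ'' (v + s * t) * t * t - 2 * c) s := by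
    intro s
    have a := (((hρ' (v + s * t)).comp s (haff s)).mul_const t).sub_const (t * ρ' v)
    have b := ((hasDerivAt_id s).const_mul 2).mul_const c
    exact (a.sub b).congr_deriv (by simp)
  obtain ⟨s1, hs1, e1⟩ := exists_hasDerivAt_eq_zero (zero_lt_one' ℝ)
    (fun s _ => (h1 s).continuousAt.continuousWithinAt) (by simp [hc])
    (fun s _ => h1 s)
  obtain ⟨s2, hs2, e2⟩ := exists_hasDerivAt_eq_zero hs1.1
    (fun s _ => (h2 s).continuousAt.continuousWithinAt)
    (by simp only [e1]; simp; ring)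
    (fun s _ => h2 s)
  refine ⟨v + s2 * t, ?_, ?_⟩
  · rw [add_sub_cancel_left, abs_mul, abs_of_pos hs2.1]
    have : s2 ≤ 1 := (hs2.2.trans hs1.2).le
    nlinarith [abs_nonneg t]
  · linarith

/-- **Kernel smoothing expansion (Lemma, part 1).**
For a symmetric bounded kernel `K ≥ 0` integrating to one with finite positive second moment
`m₂ = ∫ x² K(x) dx`, and `ρ : ℝ → ℝ` twice differentiable with bounded second derivative,
the integral `∫ K((x−v)/h) ρ(x) dx` is finite and equals
`h ρ(v) + h³ (ρ''(v)/2) m₂ + R(v,h)` with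
`|R(v,h)| ≤ h³ (‖ρ''‖_∞ ∫_{|x| > h^{-1/2}} x² K(x) dx + (m₂/2) sup_{|s−v| ≤ h^{1/2}} |ρ''(s) − ρ''(v)|)`.
In particular `R(v,h) = O(h³)` as `h → 0⁺`, and `R(v,h) = o(h³)` if `ρ''` is continuous at `v`. -/
theorem kernel_expansion
    (K : ℝ → ℝ) (hKmeas : Measurable K) (hKnonneg : ∀ x, 0 ≤ K x)
    (hKint : Integrable K) (hKone : ∫ x, K x = 1)
    (hKsymm : ∀ x, K (-x) = K x)
    (hKbdd : ∃ C : ℝ, ∀ x, K x ≤ C)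
    (hKx2int : Integrable (fun x => x ^ 2 * K x))
    (hKx2pos : 0 < ∫ x, x ^ 2 * K x)
    (ρ ρ' ρ'' : ℝ → ℝ)
    (hρ : ∀ x, HasDerivAt ρ (ρ' x) x) (hρ' : ∀ x, HasDerivAt ρ' (ρ'' x) x)
    (hρ''bdd : BddAbove (Set.range fun x => |ρ'' x|))
    (v : ℝ) :
    (∀ h : ℝ, 0 < h →
      Integrable (fun x => K ((x - v) / h) * ρ x) ∧
      |(∫ x, K ((x - v) / h) * ρ x) -
          (h * ρ v + h ^ 3 * (ρ'' v / 2) * ∫ x, x ^ 2 * K x)| ≤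
        h ^ 3 * ((⨆ x, |ρ'' x|) * (∫ x in {x : ℝ | (Real.sqrt h)⁻¹ < |x|}, x ^ 2 * K x) +
          ((∫ x, x ^ 2 * K x) / 2) *
            (⨆ s : Metric.closedBall v (Real.sqrt h), |ρ'' (s : ℝ) - ρ'' v|)))
    ∧ (fun h : ℝ => (∫ x, K ((x - v) / h) * ρ x) -
        (h * ρ v + h ^ 3 * (ρ'' v / 2) * ∫ x, x ^ 2 * K x))
        =O[nhdsWithin 0 (Set.Ioi 0)] (fun h : ℝ => h ^ 3)
    ∧ (ContinuousAt ρ'' v →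
        (fun h : ℝ => (∫ x, K ((x - v) / h) * ρ x) -
          (h * ρ v + h ^ 3 * (ρ'' v / 2) * ∫ x, x ^ 2 * K x))
          =o[nhdsWithin 0 (Set.Ioi 0)] (fun h : ℝ => h ^ 3)) := by
  set m := ∫ x, x ^ 2 * K x with hm
  set M := ⨆ x, |ρ'' x| with hM
  have hMle : ∀ x, |ρ'' x| ≤ M := fun x => le_ciSup hρ''bdd x
  have hM0 : 0 ≤ M := (abs_nonneg _).trans (hMle v)
  have hd : ∀ x, |ρ'' x - ρ'' v| ≤ 2 * M := fun x => by
    have := abs_sub (ρ'' x) (ρ'' v)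
    linarith [hMle x, hMle v]
  have hSb : ∀ h : ℝ, BddAbove (Set.range fun s : Metric.closedBall v (Real.sqrt h) =>
      |ρ'' (s : ℝ) - ρ'' v|) := by
    rintro h
    refine ⟨2 * M, ?_⟩
    rintro _ ⟨s, rfl⟩
    exact hd s
  set S : ℝ → ℝ := fun h => ⨆ s : Metric.closedBall v (Real.sqrt h), |ρ'' (s : ℝ) - ρ'' v| with hS
  have hS0 : ∀ h, 0 ≤ S h := fun h => Real.iSup_nonneg (fun _ => abs_nonneg _)
  have hx2K : ∀ x, 0 ≤ x ^ 2 * K x := fun x => mul_nonneg (sq_nonneg x) (hKnonneg x)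
  have hρc : Continuous ρ := continuous_iff_continuousAt.2 fun x => (hρ x).continuousAt
  have hxK : Integrable (fun x => x * K x) := by
    refine (hKint.add hKx2int).mono' (measurable_id.mul hKmeas).aestronglyMeasurable ?_
    refine ae_of_all _ fun x => ?_
    rw [Real.norm_eq_abs, abs_mul, abs_of_nonneg (hKnonneg x)]
    have : |x| ≤ 1 + x ^ 2 := by nlinarith [sq_abs x, sq_nonneg (|x| - 1), abs_nonneg x]
    simp only [Pi.add_apply]
    nlinarith [hKnonneg x]
  have hxK0 : ∫ x, x * K x = 0 := by
    have := integral_neg_eq_self (fun x => x * K x) volume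
    simp only [hKsymm, neg_mul, integral_neg] at this
    linarith
  have hmeasA : ∀ h : ℝ, MeasurableSet {x : ℝ | (Real.sqrt h)⁻¹ < |x|} := fun h =>
    measurableSet_lt measurable_const measurable_id.abs
  set T : ℝ → ℝ := fun h => ∫ x in {x : ℝ | (Real.sqrt h)⁻¹ < |x|}, x ^ 2 * K x with hT
  have main : ∀ h : ℝ, 0 < h →
      Integrable (fun x => K ((x - v) / h) * ρ x) ∧
      |(∫ x, K ((x - v) / h) * ρ x) - (h * ρ v + h ^ 3 * (ρ'' v / 2) * m)| ≤
        h ^ 3 * (M * T h + (m / 2) * S h) := by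
    intro h hh
    set A := {x : ℝ | (Real.sqrt h)⁻¹ < |x|} with hA
    set r : ℝ → ℝ := fun y => K y * (ρ (v + h * y) - ρ v - h * y * ρ' v - (h * y) ^ 2 / 2 * ρ'' v)
      with hr
    have hrm : Measurable r := by
      refine hKmeas.mul ?_
      refine Continuous.measurable ?_
      fun_prop
    set g : ℝ → ℝ := fun y => h ^ 2 * M * A.indicator (fun x => x ^ 2 * K x) y
      + h ^ 2 / 2 * S h * (y ^ 2 * K y) with hg
    have hgi : Integrable g :=
      ((hKx2int.indicator (hmeasA h)).const_mul _).add (hKx2int.const_mul _)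
    have hrg : ∀ y, ‖r y‖ ≤ g y := by
      intro y
      obtain ⟨ξ, hξ, e⟩ := taylor_two ρ ρ' ρ'' hρ hρ' v (h * y)
      have e2 : r y = (h ^ 2 / 2) * (y ^ 2 * K y) * (ρ'' ξ - ρ'' v) := by
        simp only [hr, e]; ring
      have hc : 0 ≤ (h ^ 2 / 2) * (y ^ 2 * K y) := mul_nonneg (by positivity) (hx2K y)
      rw [e2, Real.norm_eq_abs, abs_mul, abs_of_nonneg hc]
      by_cases hy : y ∈ A
      · simp only [hg, Set.indicator_of_mem hy]
        have h1 := mul_le_mul_of_nonneg_left (hd ξ) hc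
        have h2 := mul_nonneg hc (hS0 h)
        linarith
      · simp only [hg, Set.indicator_of_notMem hy]
        have hy' : |y| ≤ (Real.sqrt h)⁻¹ := not_lt.1 hy
        have hs : 0 < Real.sqrt h := Real.sqrt_pos.2 hh
        have hξ2 : ξ ∈ Metric.closedBall v (Real.sqrt h) := by
          rw [Metric.mem_closedBall, Real.dist_eq]
          refine hξ.trans ?_
          rw [abs_mul, abs_of_pos hh]
          calc h * |y| ≤ h * (Real.sqrt h)⁻¹ := by gcongr
            _ = Real.sqrt h := by
              rw [← div_eq_mul_inv]; exact Real.div_sqrt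
        have h3 : |ρ'' ξ - ρ'' v| ≤ S h := le_ciSup (hSb h) ⟨ξ, hξ2⟩
        have h1 := mul_le_mul_of_nonneg_left h3 hc
        linarith
    have hri : Integrable r :=
      hgi.mono' hrm.aestronglyMeasurable (ae_of_all _ hrg)
    have hrb : |∫ y, r y| ≤ h ^ 2 * M * T h + h ^ 2 / 2 * S h * m := by
      have := norm_integral_le_of_norm_le hgi (ae_of_all _ hrg)
      rw [Real.norm_eq_abs] at this
      refine this.trans (le_of_eq ?_)
      simp only [hg]
      rw [integral_add ((hKx2int.indicator (hmeasA h)).const_mul _) (hKx2int.const_mul _),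
        integral_const_mul, integral_const_mul, integral_indicator (hmeasA h)]
    have hF : (fun y => K y * ρ (v + h * y)) =
        fun y => ((r y + ρ v * K y) + (h * ρ' v) * (y * K y))
          + (h ^ 2 / 2 * ρ'' v) * (y ^ 2 * K y) := by
      funext y; simp only [hr]; ring
    have i1 := hri.add (hKint.const_mul (ρ v))
    have i2 := i1.add (hxK.const_mul (h * ρ' v))
    have hFi : Integrable (fun y => K y * ρ (v + h * y)) := by
      rw [hF]
      exact i2.add (hKx2int.const_mul _)
    have hFint : ∫ y, K y * ρ (v + h * y) = (∫ y, r y) + ρ v + h ^ 2 / 2 * ρ'' v * m := by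
      rw [hF]
      erw [integral_add i2 (hKx2int.const_mul _), integral_add i1 (hxK.const_mul _),
        integral_add hri (hKint.const_mul _)]
      rw [integral_const_mul, integral_const_mul, integral_const_mul, hxK0, hKone]
      ring
    have hcomp : (fun x => K ((x - v) / h) * ρ x) =
        fun x => (fun y => K y * ρ (v + h * y)) ((x - v) / h) := by
      funext x
      have : v + h * ((x - v) / h) = x := by field_simp; ring
      simp only [this]
    have hint : Integrable (fun x => K ((x - v) / h) * ρ x) := by
      rw [hcomp]
      exact (hFi.comp_div hh.ne').comp_sub_right v
    refine ⟨hint, ?_⟩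
    have hval : ∫ x, K ((x - v) / h) * ρ x = h * ∫ y, K y * ρ (v + h * y) := by
      rw [hcomp]
      rw [integral_sub_right_eq_self
        (fun x => (fun y => K y * ρ (v + h * y)) (x / h)) v,
        Measure.integral_comp_div (fun y => K y * ρ (v + h * y)) h, abs_of_pos hh, smul_eq_mul]
    rw [hval, hFint]
    have : h * ((∫ y, r y) + ρ v + h ^ 2 / 2 * ρ'' v * m) - (h * ρ v + h ^ 3 * (ρ'' v / 2) * m)
        = h * ∫ y, r y := by ring
    rw [this, abs_mul, abs_of_pos hh]
    calc h * |∫ y, r y| ≤ h * (h ^ 2 * M * T h + h ^ 2 / 2 * S h * m) := by gcongr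
      _ = _ := by ring
  have hm0 : 0 < m := hKx2pos
  refine ⟨main, ?_, ?_⟩
  · refine IsBigO.of_bound (M * m + m / 2 * (2 * M)) ?_
    filter_upwards [self_mem_nhdsWithin] with h hh
    have hh : 0 < h := hh
    have hTm : T h ≤ m := setIntegral_le_integral hKx2int (ae_of_all _ hx2K)
    have hS2 : S h ≤ 2 * M := Real.iSup_le (fun s => hd s) (by positivity)
    rw [Real.norm_eq_abs, Real.norm_eq_abs, abs_of_pos (pow_pos hh 3), mul_comm _ (h ^ 3)]
    refine (main h hh).2.trans ?_
    gcongr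
  · intro hcont
    have hsq : Tendsto Real.sqrt (nhdsWithin 0 (Set.Ioi 0)) (nhds 0) := by
      have := Real.continuous_sqrt.tendsto 0
      rw [Real.sqrt_zero] at this
      exact this.mono_left nhdsWithin_le_nhds
    have hsq2 : Tendsto (fun h => (Real.sqrt h)⁻¹) (nhdsWithin 0 (Set.Ioi 0)) atTop := by
      refine tendsto_inv_nhdsGT_zero.comp ?_
      refine tendsto_nhdsWithin_iff.2 ⟨hsq, ?_⟩
      filter_upwards [self_mem_nhdsWithin] with h hh
      exact Real.sqrt_pos.2 hh
    have hT0 : Tendsto T (nhdsWithin 0 (Set.Ioi 0)) (nhds 0) := by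
      have key : Tendsto (fun h : ℝ => ∫ x, {x : ℝ | (Real.sqrt h)⁻¹ < |x|}.indicator
          (fun x => x ^ 2 * K x) x) (nhdsWithin 0 (Set.Ioi 0)) (nhds (∫ _x : ℝ, (0 : ℝ))) := by
        refine tendsto_integral_filter_of_dominated_convergence (fun x => x ^ 2 * K x) ?_ ?_
          hKx2int ?_
        · exact Eventually.of_forall fun h => (hKx2int.indicator (hmeasA h)).aestronglyMeasurable
        · refine Eventually.of_forall fun h => ae_of_all _ fun x => ?_
          refine (norm_indicator_le_norm_self _ _).trans ?_
          rw [Real.norm_eq_abs, abs_of_nonneg (hx2K x)]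
        · refine ae_of_all _ fun x => ?_
          refine tendsto_const_nhds.congr' ?_
          filter_upwards [hsq2.eventually_ge_atTop |x|] with h hx
          have hn : x ∉ {x : ℝ | (Real.sqrt h)⁻¹ < |x|} := by
            simpa only [Set.mem_setOf_eq, not_lt] using hx
          exact (Set.indicator_of_notMem hn _).symm
      simp only [integral_zero] at key
      refine key.congr fun h => ?_
      exact integral_indicator (hmeasA h)
    have hS00 : Tendsto S (nhdsWithin 0 (Set.Ioi 0)) (nhds 0) := by
      rw [Metric.tendsto_nhds]
      intro ε hε
      obtain ⟨δ, hδ, H⟩ := Metric.continuousAt_iff.1 hcont (ε / 2) (half_pos hε)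
      filter_upwards [hsq.eventually_lt_const hδ] with h hh
      rw [Real.dist_eq, sub_zero, abs_of_nonneg (hS0 h)]
      refine lt_of_le_of_lt (Real.iSup_le (fun s => ?_) (half_pos hε).le) (half_lt_self hε)
      have := H (lt_of_le_of_lt (Metric.mem_closedBall.1 s.2) hh)
      rw [Real.dist_eq] at this
      exact this.le
    have hB : Tendsto (fun h => M * T h + m / 2 * S h) (nhdsWithin 0 (Set.Ioi 0)) (nhds 0) := by
      simpa using (hT0.const_mul M).add (hS00.const_mul (m / 2))
    rw [isLittleO_iff]
    intro c hc
    filter_upwards [self_mem_nhdsWithin, hB.eventually_lt_const hc] with h hh hlt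
    have hh : 0 < h := hh
    rw [Real.norm_eq_abs, Real.norm_eq_abs, abs_of_pos (pow_pos hh 3), mul_comm c (h ^ 3)]
    refine (main h hh).2.trans ?_
    gcongr
end

section
/- For all v ∈ ℝ and h > 0, the integral ∫_ℝ K((x−v)/h)²·ρ(x) dx is finite and equals h·ρ(v)·∫_ℝ K(x)² dx + h³·(ρ''(v)/2)·∫_ℝ x²K(x)² dx + R̄(v,h), where the remainder satisfies |R̄(v,h)| ≤ h³·( ‖ρ''‖_∞ · ∫_{|x|>h^{−1/2}} x²K(x)² dx + (1/2)·(∫_ℝ x²K(x)² dx)·sup_{|s−v|≤h^{1/2}} |ρ''(s)−ρ''(v)| ). In particular R̄(v,h) = O(h³) as h → 0, and if ρ'' is continuous at v then R̄(v,h) = o(h³) as h → 0. -/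
open MeasureTheory Filter Asymptotics

lemma taylor_aux (ρ ρ' ρ'' : ℝ → ℝ)
    (hρ : ∀ x, HasDerivAt ρ (ρ' x) x) (hρ' : ∀ x, HasDerivAt ρ' (ρ'' x) x) (v y : ℝ) :
    ∃ c ∈ Set.Ioo (0:ℝ) 1, ρ (v + y) - ρ v - y * ρ' v = y ^ 2 / 2 * ρ'' (v + c * y) := by
  have hl : ∀ t : ℝ, HasDerivAt (fun t : ℝ => v + t * y) y t := fun t => by
    simpa using ((hasDerivAt_id t).mul_const y).const_add v
  have h0 : ∀ t : ℝ, HasDerivAt (fun t => ρ (v + t * y)) (ρ' (v + t * y) * y) t := fun t =>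
    (hρ _).comp t (hl t)
  have h1 : ∀ t : ℝ, HasDerivAt (fun t => ρ' (v + t * y)) (ρ'' (v + t * y) * y) t := fun t =>
    (hρ' _).comp t (hl t)
  have h2 : ∀ t : ℝ, HasDerivAt (fun t : ℝ => 1 - t) (-1) t := fun t => by
    simpa using (hasDerivAt_id t).const_sub 1
  have hF : ∀ t : ℝ, HasDerivAt (fun t => ρ (v + t * y) + (1 - t) * (ρ' (v + t * y) * y))
      ((1 - t) * y ^ 2 * ρ'' (v + t * y)) t := fun t => by
    refine ((h0 t).add ((h2 t).mul ((h1 t).mul_const y))).congr_deriv ?_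
    ring
  have hG : ∀ t : ℝ, HasDerivAt (fun t : ℝ => -((1 - t) * (1 - t)) / 2) (1 - t) t := fun t => by
    refine ((((h2 t).mul (h2 t)).neg).div_const 2).congr_deriv ?_
    ring
  obtain ⟨c, hc, e⟩ := exists_ratio_hasDerivAt_eq_ratio_slope
    (fun t => ρ (v + t * y) + (1 - t) * (ρ' (v + t * y) * y)) _ zero_lt_one
    (fun t _ => (hF t).continuousAt.continuousWithinAt) (fun t _ => hF t)
    (fun t : ℝ => -((1 - t) * (1 - t)) / 2) _
    (fun t _ => (hG t).continuousAt.continuousWithinAt) (fun t _ => hG t)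
  refine ⟨c, hc, ?_⟩
  have hc1 : (1 - c) ≠ 0 := by have := hc.2; linarith
  apply mul_left_cancel₀ hc1
  simp at e
  linarith

/-- **Kernel smoothing expansion (Lemma, part 2: squared kernel).**
For a symmetric bounded kernel `K ≥ 0` integrating to one with finite positive second moment,
and `ρ : ℝ → ℝ` twice differentiable with bounded second derivative, the integral
`∫ K((x−v)/h)² ρ(x) dx` is finite and equals
`h ρ(v) ∫K² + h³ (ρ''(v)/2) ∫x²K(x)² dx + R̄(v,h)` with
`|R̄(v,h)| ≤ h³ (‖ρ''‖_∞ ∫_{|x| > h^{-1/2}} x² K(x)² dx + (1/2)(∫x²K(x)² dx) sup_{|s−v| ≤ h^{1/2}} |ρ''(s) − ρ''(v)|)`.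
In particular `R̄(v,h) = O(h³)` as `h → 0⁺`, and `R̄(v,h) = o(h³)` if `ρ''` is continuous at `v`. -/
theorem kernel_expansion_sq
    (K : ℝ → ℝ) (hKmeas : Measurable K) (hKnonneg : ∀ x, 0 ≤ K x)
    (hKint : Integrable K) (hKone : ∫ x, K x = 1)
    (hKsymm : ∀ x, K (-x) = K x)
    (hKbdd : ∃ C : ℝ, ∀ x, K x ≤ C)
    (hKx2int : Integrable (fun x => x ^ 2 * K x))
    (hKx2pos : 0 < ∫ x, x ^ 2 * K x)
    (ρ ρ' ρ'' : ℝ → ℝ)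
    (hρ : ∀ x, HasDerivAt ρ (ρ' x) x) (hρ' : ∀ x, HasDerivAt ρ' (ρ'' x) x)
    (hρ''bdd : BddAbove (Set.range fun x => |ρ'' x|))
    (v : ℝ) :
    (∀ h : ℝ, 0 < h →
      Integrable (fun x => (K ((x - v) / h)) ^ 2 * ρ x) ∧
      |(∫ x, (K ((x - v) / h)) ^ 2 * ρ x) -
          (h * ρ v * (∫ x, (K x) ^ 2) + h ^ 3 * (ρ'' v / 2) * ∫ x, x ^ 2 * (K x) ^ 2)| ≤
        h ^ 3 * ((⨆ x, |ρ'' x|) * (∫ x in {x : ℝ | (Real.sqrt h)⁻¹ < |x|}, x ^ 2 * (K x) ^ 2) +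
          (1 / 2) * (∫ x, x ^ 2 * (K x) ^ 2) *
            (⨆ s : Metric.closedBall v (Real.sqrt h), |ρ'' (s : ℝ) - ρ'' v|)))
    ∧ (fun h : ℝ => (∫ x, (K ((x - v) / h)) ^ 2 * ρ x) -
        (h * ρ v * (∫ x, (K x) ^ 2) + h ^ 3 * (ρ'' v / 2) * ∫ x, x ^ 2 * (K x) ^ 2))
        =O[nhdsWithin 0 (Set.Ioi 0)] (fun h : ℝ => h ^ 3)
    ∧ (ContinuousAt ρ'' v →
        (fun h : ℝ => (∫ x, (K ((x - v) / h)) ^ 2 * ρ x) -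
          (h * ρ v * (∫ x, (K x) ^ 2) + h ^ 3 * (ρ'' v / 2) * ∫ x, x ^ 2 * (K x) ^ 2))
          =o[nhdsWithin 0 (Set.Ioi 0)] (fun h : ℝ => h ^ 3)) := by
  obtain ⟨C, hC⟩ := hKbdd
  have hCn : 0 ≤ C := (hKnonneg 0).trans (hC 0)
  set M : ℝ := ⨆ x, |ρ'' x| with hMdef
  have hM : ∀ x, |ρ'' x| ≤ M := fun x => le_ciSup hρ''bdd x
  have hM0 : 0 ≤ M := (abs_nonneg _).trans (hM 0)
  have hM2 : ∀ s, |ρ'' s - ρ'' v| ≤ 2 * M := fun s => by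
    have := abs_sub (ρ'' s) (ρ'' v)
    linarith [hM s, hM v]
  have hρc : Continuous ρ := continuous_iff_continuousAt.2 fun x => (hρ x).continuousAt
  have hsqle : ∀ x, K x ^ 2 ≤ C * K x := fun x => by nlinarith [hC x, hKnonneg x]
  have hI0 : Integrable (fun x => K x ^ 2) := by
    refine (hKint.const_mul C).mono' (by fun_prop) (Eventually.of_forall fun x => ?_)
    rw [Real.norm_of_nonneg (by positivity)]; exact hsqle x
  have hI2 : Integrable (fun x => x ^ 2 * K x ^ 2) := by
    refine (hKx2int.const_mul C).mono' (by fun_prop) (Eventually.of_forall fun x => ?_)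
    rw [Real.norm_of_nonneg (by positivity)]
    nlinarith [hsqle x, sq_nonneg x]
  have hI1 : Integrable (fun x => x * K x ^ 2) := by
    refine (hI0.add hI2).mono' (by fun_prop) (Eventually.of_forall fun x => ?_)
    rw [Real.norm_eq_abs, abs_mul, abs_of_nonneg (sq_nonneg (K x))]
    have : |x| ≤ 1 + x ^ 2 := by nlinarith [sq_abs x, sq_nonneg (|x| - 1)]
    have := mul_le_mul_of_nonneg_right this (sq_nonneg (K x))
    simp only [Pi.add_apply]; linarith
  have hodd : ∫ x, x * K x ^ 2 = 0 := by
    have h1 := integral_neg_eq_self (fun x => x * K x ^ 2) volume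
    simp only [hKsymm, neg_mul, integral_neg] at h1
    linarith
  set J : ℝ := ∫ x, x ^ 2 * K x ^ 2 with hJ
  have hJ0 : 0 ≤ J := integral_nonneg fun x => by positivity
  have hSb : ∀ h : ℝ, BddAbove (Set.range fun s : Metric.closedBall v (Real.sqrt h) =>
      |ρ'' (s : ℝ) - ρ'' v|) := fun h => ⟨2 * M, by rintro _ ⟨s, rfl⟩; exact hM2 s⟩
  have hS0 : ∀ h : ℝ, 0 ≤ ⨆ s : Metric.closedBall v (Real.sqrt h), |ρ'' (s : ℝ) - ρ'' v| :=
    fun h => Real.iSup_nonneg fun s => abs_nonneg _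
  have hmeasA : ∀ h : ℝ, MeasurableSet {x : ℝ | (Real.sqrt h)⁻¹ < |x|} := fun h =>
    measurableSet_lt measurable_const (by fun_prop)
  have main : ∀ h : ℝ, 0 < h →
      Integrable (fun x => (K ((x - v) / h)) ^ 2 * ρ x) ∧
      |(∫ x, (K ((x - v) / h)) ^ 2 * ρ x) -
          (h * ρ v * (∫ x, (K x) ^ 2) + h ^ 3 * (ρ'' v / 2) * J)| ≤
        h ^ 3 * (M * (∫ x in {x : ℝ | (Real.sqrt h)⁻¹ < |x|}, x ^ 2 * (K x) ^ 2) +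
          (1 / 2) * J *
            (⨆ s : Metric.closedBall v (Real.sqrt h), |ρ'' (s : ℝ) - ρ'' v|)) := by
    intro h hh
    set S := ⨆ s : Metric.closedBall v (Real.sqrt h), |ρ'' (s : ℝ) - ρ'' v| with hS
    set A := {x : ℝ | (Real.sqrt h)⁻¹ < |x|} with hA
    set E : ℝ → ℝ := fun x =>
      ρ (v + h * x) - ρ v - h * x * ρ' v - (h * x) ^ 2 / 2 * ρ'' v with hE
    have hEc : Continuous E := by fun_prop
    have hrep : ∀ x, ∃ c ∈ Set.Ioo (0:ℝ) 1,
        |E x| = (h * x) ^ 2 / 2 * |ρ'' (v + c * (h * x)) - ρ'' v| := fun x => by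
      obtain ⟨c, hc, e⟩ := taylor_aux ρ ρ' ρ'' hρ hρ' v (h * x)
      refine ⟨c, hc, ?_⟩
      simp only [hE]
      rw [e, ← mul_sub, abs_mul, abs_of_nonneg (by positivity : 0 ≤ (h * x) ^ 2 / 2)]
    have hE1 : ∀ x, |E x| ≤ h ^ 2 * M * x ^ 2 := fun x => by
      obtain ⟨c, hc, e⟩ := hrep x
      rw [e]
      have := mul_le_mul_of_nonneg_left (hM2 (v + c * (h * x)))
        (by positivity : 0 ≤ (h * x) ^ 2 / 2)
      linarith
    have hE2 : ∀ x, x ∉ A → |E x| ≤ h ^ 2 / 2 * S * x ^ 2 := fun x hx => by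
      obtain ⟨c, hc, e⟩ := hrep x
      rw [e]
      have hxs : |x| ≤ (Real.sqrt h)⁻¹ := not_lt.1 hx
      have hs : 0 < Real.sqrt h := Real.sqrt_pos.2 hh
      have hball : v + c * (h * x) ∈ Metric.closedBall v (Real.sqrt h) := by
        rw [Metric.mem_closedBall, Real.dist_eq, add_sub_cancel_left, abs_mul, abs_mul,
          abs_of_pos hc.1, abs_of_pos hh]
        have h3 : h * |x| ≤ Real.sqrt h := by
          calc h * |x| ≤ h * (Real.sqrt h)⁻¹ := by gcongr
            _ = Real.sqrt h := by
              rw [← div_eq_mul_inv, Real.div_sqrt]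
        have : 0 ≤ h * |x| := by positivity
        nlinarith [hc.2, hc.1]
      have h4 : |ρ'' (v + c * (h * x)) - ρ'' v| ≤ S := le_ciSup (hSb h) ⟨_, hball⟩
      have := mul_le_mul_of_nonneg_left h4 (by positivity : 0 ≤ (h * x) ^ 2 / 2)
      linarith
    have hIE : Integrable (fun x => K x ^ 2 * E x) := by
      refine (hI2.const_mul (h ^ 2 * M)).mono'
        ((hKmeas.pow_const 2).mul hEc.measurable).aestronglyMeasurable
        (Eventually.of_forall fun x => ?_)
      rw [Real.norm_eq_abs, abs_mul, abs_of_nonneg (sq_nonneg (K x))]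
      have := mul_le_mul_of_nonneg_left (hE1 x) (sq_nonneg (K x))
      linarith
    have hdec : (fun x => K x ^ 2 * ρ (v + h * x)) = fun x =>
        ρ v * K x ^ 2 + h * ρ' v * (x * K x ^ 2) + h ^ 2 * (ρ'' v / 2) * (x ^ 2 * K x ^ 2)
          + K x ^ 2 * E x := by
      funext x; simp only [hE]; ring
    have a1 := hI0.const_mul (ρ v)
    have a2 := hI1.const_mul (h * ρ' v)
    have a3 := hI2.const_mul (h ^ 2 * (ρ'' v / 2))
    have hItot : Integrable (fun x => K x ^ 2 * ρ (v + h * x)) := by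
      rw [hdec]; exact ((a1.add a2).add a3).add hIE
    have htot : ∫ x, K x ^ 2 * ρ (v + h * x) =
        ρ v * (∫ x, K x ^ 2) + h ^ 2 * (ρ'' v / 2) * J + ∫ x, K x ^ 2 * E x := by
      have a12 : Integrable (fun x => ρ v * K x ^ 2 + h * ρ' v * (x * K x ^ 2)) := a1.add a2
      have a123 : Integrable (fun x => ρ v * K x ^ 2 + h * ρ' v * (x * K x ^ 2)
          + h ^ 2 * (ρ'' v / 2) * (x ^ 2 * K x ^ 2)) := a12.add a3
      rw [hdec, integral_add a123 hIE, integral_add a12 a3,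
        integral_add a1 a2, integral_const_mul, integral_const_mul, integral_const_mul, hodd]
      simp [hJ]
    have hcv : (fun x => K ((x - v) / h) ^ 2 * ρ x) =
        fun x => (fun y => (fun z => K z ^ 2 * ρ (v + h * z)) (y / h)) (x - v) := by
      funext x
      have : v + h * ((x - v) / h) = x := by field_simp; ring
      simp only [this]
    have hci : ∫ x, K ((x - v) / h) ^ 2 * ρ x = h * ∫ x, K x ^ 2 * ρ (v + h * x) := by
      rw [hcv, integral_sub_right_eq_self (fun y => (fun z => K z ^ 2 * ρ (v + h * z)) (y / h)) v,
        Measure.integral_comp_div (fun z => K z ^ 2 * ρ (v + h * z)) h, abs_of_pos hh, smul_eq_mul]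
    refine ⟨?_, ?_⟩
    · rw [hcv]
      exact (hItot.comp_div hh.ne').comp_sub_right v
    · rw [hci, htot]
      have e : h * (ρ v * (∫ x, K x ^ 2) + h ^ 2 * (ρ'' v / 2) * J + ∫ x, K x ^ 2 * E x) -
          (h * ρ v * (∫ x, K x ^ 2) + h ^ 3 * (ρ'' v / 2) * J) = h * ∫ x, K x ^ 2 * E x := by
        ring
      rw [e, abs_mul, abs_of_pos hh]
      have b1 : Integrable (fun x => h ^ 2 * M * A.indicator (fun x => x ^ 2 * K x ^ 2) x) :=
        (hI2.indicator (hmeasA h)).const_mul _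
      have b2 : Integrable (fun x => h ^ 2 / 2 * S * (x ^ 2 * K x ^ 2)) := hI2.const_mul _
      have key : |∫ x, K x ^ 2 * E x| ≤ h ^ 2 * M * (∫ x in A, x ^ 2 * K x ^ 2) +
          h ^ 2 / 2 * S * J := by
        rw [← integral_indicator (hmeasA h), hJ, ← integral_const_mul, ← integral_const_mul,
          ← integral_add b1 b2, ← Real.norm_eq_abs]
        refine norm_integral_le_of_norm_le (b1.add b2) (Eventually.of_forall fun x => ?_)
        rw [Real.norm_eq_abs, abs_mul, abs_of_nonneg (sq_nonneg (K x))]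
        have hS0' := hS0 h
        by_cases hx : x ∈ A
        · rw [Set.indicator_of_mem hx]
          have := mul_le_mul_of_nonneg_left (hE1 x) (sq_nonneg (K x))
          have : 0 ≤ h ^ 2 / 2 * S * (x ^ 2 * K x ^ 2) := by positivity
          linarith
        · rw [Set.indicator_of_notMem hx]
          have := mul_le_mul_of_nonneg_left (hE2 x hx) (sq_nonneg (K x))
          linarith
      have := mul_le_mul_of_nonneg_left key hh.le
      linarith
  refine ⟨main, ?_, ?_⟩
  · refine IsBigO.of_bound (2 * M * J) ?_
    filter_upwards [self_mem_nhdsWithin] with h hh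
    have hh : 0 < h := hh
    rw [Real.norm_eq_abs, Real.norm_of_nonneg (by positivity)]
    refine (main h hh).2.trans ?_
    rw [mul_comm]
    gcongr
    have t1 : ∫ x in {x : ℝ | (Real.sqrt h)⁻¹ < |x|}, x ^ 2 * (K x) ^ 2 ≤ J :=
      setIntegral_le_integral hI2 (Eventually.of_forall fun x => by positivity)
    haveI : Nonempty (Metric.closedBall v (Real.sqrt h)) :=
      ⟨⟨v, Metric.mem_closedBall_self (Real.sqrt_nonneg h)⟩⟩
    have t2 : (⨆ s : Metric.closedBall v (Real.sqrt h), |ρ'' (s : ℝ) - ρ'' v|) ≤ 2 * M :=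
      ciSup_le fun s => hM2 s
    have := mul_le_mul_of_nonneg_left t1 hM0
    have := mul_le_mul_of_nonneg_left t2 hJ0
    linarith
  · intro hcont
    have hsq : Tendsto Real.sqrt (nhdsWithin 0 (Set.Ioi 0)) (nhdsWithin 0 (Set.Ioi 0)) := by
      refine tendsto_nhdsWithin_iff.2 ⟨?_, ?_⟩
      · have := Real.continuous_sqrt.tendsto 0
        rw [Real.sqrt_zero] at this
        exact this.mono_left nhdsWithin_le_nhds
      · filter_upwards [self_mem_nhdsWithin] with h hh
        exact Real.sqrt_pos.2 hh
    have hT : Tendsto (fun h : ℝ => ∫ x in {x : ℝ | (Real.sqrt h)⁻¹ < |x|}, x ^ 2 * (K x) ^ 2)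
        (nhdsWithin 0 (Set.Ioi 0)) (nhds 0) := by
      have : Tendsto (fun h : ℝ => ∫ x, {x : ℝ | (Real.sqrt h)⁻¹ < |x|}.indicator
          (fun x => x ^ 2 * (K x) ^ 2) x)
          (nhdsWithin 0 (Set.Ioi 0)) (nhds (∫ x : ℝ, (0:ℝ))) := by
        refine tendsto_integral_filter_of_dominated_convergence _
          (Eventually.of_forall fun h => (hI2.indicator (hmeasA h)).aestronglyMeasurable)
          (Eventually.of_forall fun h => Eventually.of_forall fun x =>
            norm_indicator_le_norm_self _ _) hI2.norm (Eventually.of_forall fun x => ?_)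
        refine tendsto_const_nhds.congr' ?_
        filter_upwards [(tendsto_inv_nhdsGT_zero.comp hsq).eventually_ge_atTop |x|] with h hx
        rw [Set.indicator_of_notMem]
        exact not_lt.2 hx
      simpa only [integral_indicator (hmeasA _), integral_zero] using this
    have hSt : Tendsto (fun h : ℝ => ⨆ s : Metric.closedBall v (Real.sqrt h),
        |ρ'' (s : ℝ) - ρ'' v|) (nhdsWithin 0 (Set.Ioi 0)) (nhds 0) := by
      rw [Metric.tendsto_nhds]
      intro ε hε
      obtain ⟨δ, hδ, hd⟩ := Metric.continuousAt_iff.1 hcont (ε / 2) (by positivity)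
      filter_upwards [(tendsto_nhdsWithin_iff.1 hsq).1.eventually_lt_const hδ] with h hx
      haveI : Nonempty (Metric.closedBall v (Real.sqrt h)) :=
        ⟨⟨v, Metric.mem_closedBall_self (Real.sqrt_nonneg h)⟩⟩
      rw [Real.dist_eq, sub_zero, abs_of_nonneg (hS0 h)]
      refine lt_of_le_of_lt (ciSup_le fun s => ?_) (half_lt_self hε)
      exact (hd (lt_of_le_of_lt s.2 hx)).le
    have hB := (hT.const_mul M).add (hSt.const_mul (1 / 2 * J))
    rw [mul_zero, mul_zero, add_zero] at hB
    refine IsLittleO.of_bound fun c hc => ?_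
    filter_upwards [self_mem_nhdsWithin, hB.eventually_le_const hc] with h hh hle
    have hh : 0 < h := hh
    rw [Real.norm_eq_abs, Real.norm_of_nonneg (by positivity)]
    refine (main h hh).2.trans ?_
    rw [mul_comm]
    gcongr
end

section
/- If in addition ρ(v) = 0 for a given v ∈ ℝ, then for every h > 0, |∫_ℝ K((x−v)/h)·ρ(x) dx| ≤ (5/2)·h³·‖ρ''‖_∞·m₂. -/
open MeasureTheory

/-- **Kernel smoothing bound when `ρ(v) = 0`.**
For a symmetric bounded kernel `K ≥ 0` integrating to one with finite positive second moment
`m₂ = ∫ x² K(x) dx`, and `ρ : ℝ → ℝ` twice differentiable with bounded second derivative,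
if `ρ(v) = 0` then for every `h > 0`,
`|∫ K((x−v)/h) ρ(x) dx| ≤ (5/2) h³ ‖ρ''‖_∞ m₂`. -/
theorem kernel_bound_of_rho_zero
    (K : ℝ → ℝ) (hKmeas : Measurable K) (hKnonneg : ∀ x, 0 ≤ K x)
    (hKint : Integrable K) (hKone : ∫ x, K x = 1)
    (hKsymm : ∀ x, K (-x) = K x)
    (hKbdd : ∃ C : ℝ, ∀ x, K x ≤ C)
    (hKx2int : Integrable (fun x => x ^ 2 * K x))
    (hKx2pos : 0 < ∫ x, x ^ 2 * K x)
    (ρ ρ' ρ'' : ℝ → ℝ)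
    (hρ : ∀ x, HasDerivAt ρ (ρ' x) x) (hρ' : ∀ x, HasDerivAt ρ' (ρ'' x) x)
    (hρ''bdd : BddAbove (Set.range fun x => |ρ'' x|))
    (v : ℝ) (hv : ρ v = 0) :
    ∀ h : ℝ, 0 < h →
      |∫ x, K ((x - v) / h) * ρ x| ≤
        (5 / 2) * h ^ 3 * (⨆ x, |ρ'' x|) * ∫ x, x ^ 2 * K x := by
  intro h hh
  set M := ⨆ x, |ρ'' x| with hM
  have hb : ∀ x, |ρ'' x| ≤ M := fun x => le_ciSup hρ''bdd x
  have hM0 : 0 ≤ M := (abs_nonneg _).trans (hb 0)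
  have hlip : ∀ x y, |ρ' y - ρ' x| ≤ M * |y - x| := by
    intro x y
    exact Convex.norm_image_sub_le_of_norm_hasDerivWithin_le (s := Set.univ) (f := ρ') (f' := ρ'')
      (fun x _ => (hρ' x).hasDerivWithinAt) (fun x _ => hb x) convex_univ
      (Set.mem_univ x) (Set.mem_univ y)
  have hg : ∀ t, |ρ (v + t) + ρ (v + -t)| ≤ 2 * M * t ^ 2 := by
    intro t
    have hd : ∀ s, HasDerivAt (fun s => ρ (v + s) + ρ (v + -s)) (ρ' (v + s) - ρ' (v + -s)) s := by
      intro s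
      have h1 : HasDerivAt (fun s => v + s) 1 s := (hasDerivAt_id s).const_add v
      have h2 : HasDerivAt (fun s => v + -s) (-1) s := (hasDerivAt_id s).neg.const_add v
      have h3 := ((hρ (v + s)).comp s h1).add ((hρ (v + -s)).comp s h2)
      exact h3.congr_deriv (by ring)
    have key := Convex.norm_image_sub_le_of_norm_hasDerivWithin_le (s := Set.Icc (-|t|) |t|)
      (C := 2 * M * |t|)
      (f := fun s => ρ (v + s) + ρ (v + -s)) (f' := fun s => ρ' (v + s) - ρ' (v + -s))
      (fun x _ => (hd x).hasDerivWithinAt) (by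
        intro s hs
        have h1 := hlip (v + -s) (v + s)
        have h2 : |s| ≤ |t| := abs_le.2 hs
        have h3 : |v + s - (v + -s)| = 2 * |s| := by
          rw [show v + s - (v + -s) = 2 * s by ring, abs_mul]; norm_num
        rw [h3] at h1
        rw [Real.norm_eq_abs]
        nlinarith) (convex_Icc _ _)
      (x := 0) (y := t) (by simp) (abs_le.1 le_rfl)
    simp only [Real.norm_eq_abs, neg_zero, add_zero, hv, sub_zero] at key
    have : |t| * |t| = t ^ 2 := by rw [abs_mul_abs_self]; ring
    nlinarith
  let F : ℝ → ℝ := fun u => K u * ρ (v + h * u)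
  have hsub : ∫ x, K ((x - v) / h) * ρ x = h * ∫ u, F u := by
    have e1 : (fun x => K ((x - v) / h) * ρ x) = fun x => F ((x - v) / h) := by
      funext x
      have : v + h * ((x - v) / h) = x := by field_simp; ring
      simp only [F, this]
    rw [e1, integral_sub_right_eq_self (fun x => F (x / h)) v, Measure.integral_comp_div,
      abs_of_pos hh, smul_eq_mul]
  have hJ : |∫ u, F u| ≤ M * h ^ 2 * ∫ x, x ^ 2 * K x := by
    by_cases hF : Integrable F
    · have e2 : ∫ u, (F u + F (-u)) = 2 * ∫ u, F u := by
        rw [integral_add hF hF.comp_neg, integral_neg_eq_self]; ring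
      have e3 : ‖∫ u, (F u + F (-u))‖ ≤ ∫ u, (2 * M * h ^ 2) * (u ^ 2 * K u) := by
        refine norm_integral_le_of_norm_le (hKx2int.const_mul _) (Filter.Eventually.of_forall ?_)
        intro u
        have h1 := hg (h * u)
        have h2 : F u + F (-u) = K u * (ρ (v + h * u) + ρ (v + -(h * u))) := by
          simp only [F, hKsymm, mul_neg]; ring
        rw [h2, Real.norm_eq_abs, abs_mul, abs_of_nonneg (hKnonneg u)]
        calc _ ≤ K u * (2 * M * (h * u) ^ 2) := mul_le_mul_of_nonneg_left h1 (hKnonneg u)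
          _ = _ := by ring
      rw [e2, integral_const_mul, Real.norm_eq_abs, abs_mul, abs_two] at e3
      linarith
    · rw [integral_undef hF, abs_zero]
      positivity
  rw [hsub, abs_mul, abs_of_pos hh]
  have h4 : 0 ≤ h ^ 3 * M * ∫ x, x ^ 2 * K x := by positivity
  calc _ ≤ h * (M * h ^ 2 * ∫ x, x ^ 2 * K x) := mul_le_mul_of_nonneg_left hJ hh.le
    _ ≤ _ := by linarith
end

section
/- If the sequence (E[|X_n| | F_n])_{n∈ℕ} is bounded in probability, then the sequence (X_n)_{n∈ℕ} is bounded in probability. -/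
open MeasureTheory Filter

/-- A sequence of real random variables `ξ` is bounded in probability (`ξ_n = O_P(1)`):
`limsup_{n→∞} P(|ξ_n| ≥ M) → 0` as `M → ∞`. -/
def BoundedInProbability {Ω : Type*} [MeasurableSpace Ω] (P : Measure Ω)
    (ξ : ℕ → Ω → ℝ) : Prop :=
  Filter.Tendsto (fun M : ℝ => Filter.limsup (fun n => P {ω | M ≤ |ξ n ω|}) Filter.atTop)
    Filter.atTop (nhds 0)

theorem cond_markov_aux
    {Ω : Type*} [m0 : MeasurableSpace Ω] (P : Measure Ω) [IsProbabilityMeasure P]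
    (X : Ω → ℝ) (F : MeasurableSpace Ω) (hF : F ≤ m0) (hint : Integrable X P)
    (K M : ℝ) (hK : 0 ≤ K) (hM : 0 < M) :
    P {ω | M ≤ |X ω|} ≤
      P {ω | K ≤ |(P[(fun ω' => |X ω'|) | F]) ω|} + ENNReal.ofReal (K / M) := by
  set Y := P[(fun ω' => |X ω'|) | F] with hY
  set A : Set Ω := {ω | K ≤ |Y ω|} with hA
  have hYm : Measurable[F] Y := stronglyMeasurable_condExp.measurable
  have hAF : MeasurableSet[F] A := by
    have h1 : Measurable[F] (fun ω => |Y ω|) := measurable_abs.comp hYm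
    exact h1 measurableSet_Ici
  have hAm : MeasurableSet[m0] A := hF _ hAF
  have hmark := mul_meas_ge_le_integral_of_nonneg (μ := P.restrict Aᶜ)
    (f := fun ω => |X ω|) (ae_of_all _ fun ω => abs_nonneg _) hint.abs.restrict M
  have hset : ∫ ω in Aᶜ, |X ω| ∂P = ∫ ω in Aᶜ, Y ω ∂P :=
    (setIntegral_condExp hF hint.abs hAF.compl).symm
  have hYK : ∫ ω in Aᶜ, Y ω ∂P ≤ K := by
    have h1 : ∫ ω in Aᶜ, Y ω ∂P ≤ ∫ ω in Aᶜ, K ∂P := by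
      refine setIntegral_mono_on integrable_condExp.integrableOn
        (integrable_const K).integrableOn hAm.compl ?_
      intro ω hω
      have : ¬ K ≤ |Y ω| := hω
      exact (le_abs_self _).trans (not_le.mp this).le
    refine h1.trans ?_
    rw [setIntegral_const, smul_eq_mul]
    exact mul_le_of_le_one_left hK measureReal_le_one
  have h2 : (P.restrict Aᶜ).real {ω | M ≤ |X ω|} ≤ K / M := by
    rw [le_div_iff₀ hM, mul_comm]
    linarith
  have h3 : P ({ω | M ≤ |X ω|} \ A) ≤ ENNReal.ofReal (K / M) := by
    rw [Set.sdiff_eq, ← Measure.restrict_apply' hAm.compl, ← ofReal_measureReal]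
    exact ENNReal.ofReal_le_ofReal h2
  calc P {ω | M ≤ |X ω|} ≤ P (A ∪ ({ω | M ≤ |X ω|} \ A)) := by
        apply measure_mono
        rw [Set.union_sdiff_self]
        exact Set.subset_union_right
    _ ≤ P A + P ({ω | M ≤ |X ω|} \ A) := measure_union_le _ _
    _ ≤ _ := by gcongr

/-- **Lemma (conditional boundedness in probability).**
If the conditional expectations `E[|X_n| | F_n]` are bounded in probability, then
`X_n` is bounded in probability. -/
theorem conditional_bounded_in_probability
    {Ω : Type*} [m0 : MeasurableSpace Ω] (P : Measure Ω) [IsProbabilityMeasure P]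
    (X : ℕ → Ω → ℝ) (F : ℕ → MeasurableSpace Ω)
    (hF : ∀ n, F n ≤ m0)
    (hint : ∀ n, Integrable (X n) P)
    (hcond : BoundedInProbability P (fun n ω => (P[(fun ω' => |X n ω'|) | F n]) ω)) :
    BoundedInProbability P X := by
  unfold BoundedInProbability at *
  have hs : Tendsto (fun M : ℝ => Real.sqrt M) atTop atTop := Real.tendsto_sqrt_atTop
  have h1 := hcond.comp hs
  have h2 : Tendsto (fun M : ℝ => ENNReal.ofReal (Real.sqrt M)⁻¹) atTop (nhds 0) := by
    have := ENNReal.tendsto_ofReal (tendsto_inv_atTop_zero.comp hs)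
    simpa using this
  have h3 := h1.add h2
  rw [add_zero] at h3
  refine tendsto_of_tendsto_of_tendsto_of_le_of_le' tendsto_const_nhds h3
    (Eventually.of_forall fun _ => zero_le) ?_
  filter_upwards [eventually_gt_atTop 0] with M hM
  have hKM : Real.sqrt M / M = (Real.sqrt M)⁻¹ := by
    rw [Real.sqrt_div_self', one_div]
  have hle := fun n => cond_markov_aux P (X n) (F n) (hF n) (hint n) (Real.sqrt M) M
    (Real.sqrt_nonneg M) hM
  simp only [hKM] at hle
  refine (limsup_le_limsup (Eventually.of_forall hle)).trans ?_
  refine (limsup_add_const atTop _ _ (by isBoundedDefault) (by isBoundedDefault)).le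
end
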